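/- arXiv:1305.2972 — 3 statements merged into one kernel-verified Lean document; each statement's English description precedes it below -/
import Mathlib

section
/- Fix q ∈ (0,1) and α ∈ (0,1). Then p_{∞,α}(j) ≥ 0 for every j ≥ 0, the series ∑_{j=0}^{∞} p_{∞,α}(j) converges, and its sum equals 1. -/
/-- The q-Pochhammer symbol `(a;q)_n = ∏_{i=0}^{n-1} (1 - a q^i)`. -/
noncomputable def qPoch (q a : ℝ) (n : ℕ) : ℝ := ∏ i ∈ Finset.range n, (1 - a * q ^ i)

/-- The infinite q-Pochhammer symbol `(a;q)_∞ = ∏_{i=0}^{∞} (1 - a q^i)`. -/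
noncomputable def qPochInf (q a : ℝ) : ℝ := ∏' i : ℕ, (1 - a * q ^ i)

/-- `p_{∞,α}(j) = α^j (α;q)_∞ / (q;q)_j` for `j ≥ 0`. -/
noncomputable def pInf (q α : ℝ) (j : ℕ) : ℝ := α ^ j * qPochInf q α / qPoch q q j

open Filter Topology

theorem qPoch_succ (q a : ℝ) (n : ℕ) : qPoch q a (n + 1) = qPoch q a n * (1 - a * q ^ n) :=
  Finset.prod_range_succ _ _

theorem one_sub_mul_pow_pos {q a : ℝ} (hq0 : 0 ≤ q) (hq1 : q ≤ 1) (ha0 : 0 ≤ a) (ha1 : a < 1)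
    (n : ℕ) : 0 < 1 - a * q ^ n := by
  have := mul_le_of_le_one_right ha0 (pow_le_one₀ (n := n) hq0 hq1)
  linarith

theorem qPoch_pos {q a : ℝ} (hq0 : 0 ≤ q) (hq1 : q ≤ 1) (ha0 : 0 ≤ a) (ha1 : a < 1) (n : ℕ) :
    0 < qPoch q a n :=
  Finset.prod_pos fun i _ => one_sub_mul_pow_pos hq0 hq1 ha0 ha1 i

theorem tendsto_qPoch_qPochInf {q : ℝ} (hq0 : 0 ≤ q) (hq1 : q < 1) (a : ℝ) :
    Tendsto (qPoch q a) atTop (𝓝 (qPochInf q a)) := by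
  have hs : Summable fun i : ℕ => -(a * q ^ i) :=
    ((summable_geometric_of_lt_one hq0 hq1).mul_left a).neg
  have hm : Multipliable fun i : ℕ => 1 - a * q ^ i := by
    simpa only [sub_eq_add_neg] using Real.multipliable_one_add_of_summable hs
  exact hm.hasProd.tendsto_prod_nat

theorem summable_pow_div_qPoch {q x : ℝ} (hq0 : 0 ≤ q) (hq1 : q < 1) (hx0 : 0 < x) (hx1 : x < 1) :
    Summable fun j : ℕ => x ^ j / qPoch q q j := by
  have hpos := qPoch_pos hq0 hq1.le hq0 hq1
  refine summable_of_ratio_test_tendsto_lt_one hx1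
    (Eventually.of_forall fun j => (div_pos (pow_pos hx0 j) (hpos j)).ne') ?_
  have hlim : Tendsto (fun j : ℕ => x / (1 - q * q ^ j)) atTop (𝓝 x) := by
    have h := ((tendsto_pow_atTop_nhds_zero_of_lt_one hq0 hq1).const_mul q).const_sub 1
    rw [mul_zero, sub_zero] at h
    simpa [Pi.div_def] using (tendsto_const_nhds (x := x)).div h one_ne_zero
  refine hlim.congr fun j => ?_
  have hfac := one_sub_mul_pow_pos hq0 hq1.le hq0 hq1 j
  rw [Real.norm_of_nonneg (div_pos (pow_pos hx0 _) (hpos _)).le,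
    Real.norm_of_nonneg (div_pos (pow_pos hx0 _) (hpos _)).le, qPoch_succ]
  have := (hpos j).ne'
  have := hfac.ne'
  field_simp
  ring

theorem tsum_mul_pow_div_qPoch {q x : ℝ} (hq0 : 0 < q) (hq1 : q < 1) (hx0 : 0 < x) (hx1 : x < 1) :
    ∑' j : ℕ, (x * q) ^ j / qPoch q q j = (1 - x) * ∑' j : ℕ, x ^ j / qPoch q q j := by
  have hs := summable_pow_div_qPoch hq0.le hq1 hx0 hx1
  have hs' := summable_pow_div_qPoch hq0.le hq1 (mul_pos hx0 hq0)
    ((mul_lt_of_lt_one_right hx0 hq1).trans hx1)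
  have hsub : (∑' j : ℕ, x ^ j / qPoch q q j) - ∑' j : ℕ, (x * q) ^ j / qPoch q q j =
      x * ∑' j : ℕ, x ^ j / qPoch q q j := by
    rw [← hs.tsum_sub hs', (hs.sub hs').tsum_eq_zero_add, ← tsum_mul_left]
    simp only [pow_zero, sub_self, zero_add]
    refine tsum_congr fun j => ?_
    have h1 := (qPoch_pos hq0.le hq1.le hq0.le hq1 j).ne'
    have h2 := (one_sub_mul_pow_pos hq0.le hq1.le hq0.le hq1 j).ne'
    rw [qPoch_succ, ← sub_div, mul_div_assoc', div_eq_div_iff (mul_ne_zero h1 h2) h1]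
    ring
  linarith

theorem tsum_mul_pow_pow_div_qPoch {q x : ℝ} (hq0 : 0 < q) (hq1 : q < 1) (hx0 : 0 < x)
    (hx1 : x < 1) (n : ℕ) :
    ∑' j : ℕ, (x * q ^ n) ^ j / qPoch q q j = qPoch q x n * ∑' j : ℕ, x ^ j / qPoch q q j := by
  induction n with
  | zero => simp [qPoch]
  | succ n ih =>
    have hlt : x * q ^ n < 1 := by linarith [one_sub_mul_pow_pos hq0.le hq1.le hx0.le hx1 n]
    rw [pow_succ, ← mul_assoc, tsum_mul_pow_div_qPoch hq0 hq1 (by positivity) hlt, ih, qPoch_succ]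
    ring

theorem tendsto_tsum_mul_pow_pow_div_qPoch {q x : ℝ} (hq0 : 0 < q) (hq1 : q < 1) (hx0 : 0 < x)
    (hx1 : x < 1) :
    Tendsto (fun n : ℕ => ∑' j : ℕ, (x * q ^ n) ^ j / qPoch q q j) atTop (𝓝 1) := by
  have hpos := qPoch_pos hq0.le hq1.le hq0.le hq1
  have hzero : ∑' j : ℕ, (0 : ℝ) ^ j / qPoch q q j = 1 := by
    rw [tsum_eq_single 0 fun j hj => by simp [hj]]
    simp [qPoch]
  rw [← hzero]
  refine tendsto_tsum_of_dominated_convergence (summable_pow_div_qPoch hq0.le hq1 hx0 hx1)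
    (fun j => ?_) (Eventually.of_forall fun n j => ?_)
  · have h := (tendsto_pow_atTop_nhds_zero_of_lt_one hq0.le hq1).const_mul x
    rw [mul_zero] at h
    exact (h.pow j).div_const _
  · rw [Real.norm_of_nonneg (div_nonneg (by positivity) (hpos j).le)]
    have := (hpos j).le
    gcongr
    exact mul_le_of_le_one_right hx0.le (pow_le_one₀ hq0.le hq1.le)

/-- Euler's identity `(x;q)_∞ ∑ x^j / (q;q)_j = 1`. -/
theorem qPochInf_mul_tsum_pow_div_qPoch {q x : ℝ} (hq0 : 0 < q) (hq1 : q < 1) (hx0 : 0 < x)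
    (hx1 : x < 1) : qPochInf q x * ∑' j : ℕ, x ^ j / qPoch q q j = 1 := by
  refine tendsto_nhds_unique ((tendsto_qPoch_qPochInf hq0.le hq1 x).mul_const _) ?_
  simpa only [tsum_mul_pow_pow_div_qPoch hq0 hq1 hx0 hx1] using
    tendsto_tsum_mul_pow_pow_div_qPoch hq0 hq1 hx0 hx1

theorem stmt_1 (q α : ℝ) (hq : q ∈ Set.Ioo (0:ℝ) 1) (hα : α ∈ Set.Ioo (0:ℝ) 1) :
    (∀ j : ℕ, 0 ≤ pInf q α j) ∧ Summable (fun j : ℕ => pInf q α j) ∧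
      ∑' j : ℕ, pInf q α j = 1 := by
  obtain ⟨hq0, hq1⟩ := hq
  obtain ⟨hα0, hα1⟩ := hα
  have hinf : 0 ≤ qPochInf q α := ge_of_tendsto' (tendsto_qPoch_qPochInf hq0.le hq1 α)
    fun n => (qPoch_pos hq0.le hq1.le hα0.le hα1 n).le
  have heq (j : ℕ) : pInf q α j = qPochInf q α * (α ^ j / qPoch q q j) := by
    rw [pInf, mul_comm, mul_div_assoc]
  refine ⟨fun j => ?_, ?_, ?_⟩
  · exact div_nonneg (mul_nonneg (pow_nonneg hα0.le j) hinf)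
      (qPoch_pos hq0.le hq1.le hq0.le hq1 j).le
  · simpa only [heq] using (summable_pow_div_qPoch hq0.le hq1 hα0 hα1).mul_left (qPochInf q α)
  · simpa only [heq, tsum_mul_left] using qPochInf_mul_tsum_pow_div_qPoch hq0 hq1 hα0 hα1
end

section
/- (Free evolution implies true evolution, Poisson case.) Fix q ∈ (0,1), integers N, k ≥ 1 and a_n > 0 for every integer n ≥ 1. Suppose u : ℝ_{≥0} × ℤ^k → ℝ is differentiable in the time variable and satisfies: (1) for all t ≥ 0 and all n⃗ ∈ ℤ^k with every coordinate ≥ 1, (d/dt) u(t;n⃗) = (1−q) ∑_{i=1}^{k} a_{n_i} ([∇]_i u(t;·))(n⃗); (2) for all t ≥ 0, every i ∈ {1,…,k−1} and every n⃗ ∈ ℤ^k with n_i = n_{i+1}, ([∇]_i − q [∇]_{i+1}) u(t;n⃗) = 0; (3) u(t;n⃗) = 0 for all t ≥ 0 whenever some coordinate of n⃗ is ≤ 0. Define h(t;y⃗) = u(t; n⃗(y⃗)) for y⃗ ∈ Y^N_k. Then for all t ≥ 0 and y⃗ ∈ Y^N_k: (d/dt) h(t;y⃗) = ∑_{i=1}^{N}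 (L^{(a_i)}_i h(t;·))(y⃗), and h(t;y⃗) = 0 whenever y_0 > 0. -/
/-- `([∇]_i f)(n⃗) = f(n⃗ - e_i) - f(n⃗)`. -/
noncomputable def nablaD {k : ℕ} (i : Fin k) (f : (Fin k → ℤ) → ℝ) (n : Fin k → ℤ) : ℝ :=
  f (Function.update n i (n i - 1)) - f n

/-- `y⃗^{s}_{i,i-1}`: move `s` units of mass from coordinate `i+1` (paper index `i+1 ∈ {1,…,N}`)
to coordinate `i` of `y⃗ ∈ Y^N = ℤ_{≥0}^{N+1}`. -/
def moveY {N : ℕ} (y : Fin (N + 1) → ℕ) (i : Fin N) (s : ℕ) : Fin (N + 1) → ℕ :=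
  Function.update (Function.update y i.succ (y i.succ - s)) i.castSucc (y i.castSucc + s)

/-- `(L^{(a)}_i f)(y⃗) = a (1 - q^{y_i}) (f(y⃗^{1}_{i,i-1}) - f(y⃗))`, where `i : Fin N`
denotes paper index `i+1`. -/
noncomputable def Lop {N : ℕ} (q a : ℝ) (i : Fin N) (f : (Fin (N + 1) → ℕ) → ℝ)
    (y : Fin (N + 1) → ℕ) : ℝ :=
  a * (1 - q ^ y i.succ) * (f (moveY y i 1) - f y)

/-- `n⃗(y⃗) ∈ ℤ^k`: the weakly decreasing vector containing exactly `y_v` entries equal to `v`. -/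
def nvec (N k : ℕ) (y : Fin (N + 1) → ℕ) (j : Fin k) : ℕ :=
  (Finset.univ.filter
    (fun v : Fin (N + 1) => (j : ℕ) < ∑ i ∈ Finset.Ici v, y i)).sup (fun v => (v : ℕ))

/-- The mass of `y` at sites `≥ v`. -/
def tailMass {N : ℕ} (y : Fin (N + 1) → ℕ) (v : Fin (N + 1)) : ℕ :=
  ∑ i ∈ Finset.Ici v, y i

theorem tailMass_antitone {N : ℕ} (y : Fin (N + 1) → ℕ) : Antitone (tailMass y) :=
  fun _ _ h => Finset.sum_le_sum_of_subset (Finset.Ici_subset_Ici.2 h)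

theorem tailMass_zero {N : ℕ} (y : Fin (N + 1) → ℕ) : tailMass y 0 = ∑ v, y v := by
  unfold tailMass
  congr 1
  ext v
  simp

theorem tailMass_castSucc {N : ℕ} (y : Fin (N + 1) → ℕ) (i : Fin N) :
    tailMass y i.castSucc = y i.castSucc + tailMass y i.succ := by
  unfold tailMass
  have h : Finset.Ici i.castSucc = insert i.castSucc (Finset.Ici i.succ) := by
    ext v
    simp only [Finset.mem_Ici, Finset.mem_insert, Fin.le_def, Fin.ext_iff, Fin.val_castSucc,
      Fin.val_succ]
    omega
  rw [h, Finset.sum_insert (by simp)]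

theorem tailMass_last {N : ℕ} (y : Fin (N + 1) → ℕ) :
    tailMass y (Fin.last N) = y (Fin.last N) := by
  unfold tailMass
  have h : Finset.Ici (Fin.last N) = {Fin.last N} := by
    ext v
    simp [Fin.last_le_iff]
  rw [h, Finset.sum_singleton]

/-- Moving one unit from `i.succ` to `i.castSucc` only lowers the tail mass at `i.succ`. -/
theorem tailMass_moveY {N : ℕ} (y : Fin (N + 1) → ℕ) (i : Fin N) (hi : 0 < y i.succ)
    (v : Fin (N + 1)) :
    tailMass (moveY y i 1) v = if v = i.succ then tailMass y v - 1 else tailMass y v := by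
  have hval : ∀ w, moveY y i 1 w =
      if w = i.castSucc then y w + 1 else if w = i.succ then y w - 1 else y w := by
    intro w
    unfold moveY
    by_cases h : w = i.castSucc
    · subst h; simp
    · by_cases h' : w = i.succ
      · subst h'; rw [if_neg h, if_pos rfl, Function.update_of_ne h, Function.update_self]
      · rw [if_neg h, if_neg h', Function.update_of_ne h, Function.update_of_ne h']
  induction v using Fin.reverseInduction with
  | last =>
    rw [tailMass_last, tailMass_last, hval]
    have : Fin.last N ≠ i.castSucc := (Fin.castSucc_lt_last i).ne'
    rw [if_neg this]
  | cast j ih =>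
    rw [tailMass_castSucc, tailMass_castSucc, ih, hval]
    have hpos : y i.succ ≤ tailMass y i.succ :=
      Finset.single_le_sum (f := y) (fun _ _ => Nat.zero_le _) (Finset.mem_Ici.2 le_rfl)
    by_cases h : j = i
    · subst h
      have hne : j.castSucc ≠ j.succ := Fin.castSucc_lt_succ.ne
      simp only [if_true, if_neg hne]
      omega
    · have h1 : j.castSucc ≠ i.castSucc := fun e => h (Fin.castSucc_injective _ e)
      have h2 : j.succ ≠ i.succ := fun e => h (Fin.succ_injective _ e)
      rw [if_neg h1, if_neg h2]
      split_ifs with h3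
      · rw [h3]; omega
      · rfl

theorem le_nvec_iff {N k : ℕ} {y : Fin (N + 1) → ℕ} (hy : ∑ v, y v = k) (j : Fin k)
    (v : Fin (N + 1)) : (v : ℕ) ≤ nvec N k y j ↔ (j : ℕ) < tailMass y v := by
  constructor
  · intro h
    rcases Nat.eq_zero_or_pos (v : ℕ) with h0 | h0
    · have : v = 0 := Fin.ext h0
      rw [this, tailMass_zero, hy]
      exact j.2
    · obtain ⟨w, hw, hvw⟩ := (Finset.le_sup_iff (by simpa using h0)).1 h
      exact lt_of_lt_of_le (Finset.mem_filter.1 hw).2 (tailMass_antitone y hvw)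
  · intro h
    exact Finset.le_sup (f := fun v : Fin (N + 1) => (v : ℕ))
      (Finset.mem_filter.2 ⟨Finset.mem_univ _, h⟩)

theorem nvec_le {N k : ℕ} (y : Fin (N + 1) → ℕ) (j : Fin k) : nvec N k y j ≤ N :=
  Finset.sup_le fun v _ => Nat.lt_succ_iff.1 v.2

/-- The sites carrying the value `i + 1` form an interval of length `y i.succ`, ending just before
`tailMass y i.succ`. -/
theorem nvec_eq_succ_iff {N k : ℕ} {y : Fin (N + 1) → ℕ} (hy : ∑ v, y v = k) (j : Fin k)
    (i : Fin N) : nvec N k y j = i + 1 ↔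
      tailMass y i.succ - y i.succ ≤ j ∧ (j : ℕ) < tailMass y i.succ := by
  have h1 := le_nvec_iff hy j i.succ
  have h2 : (i : ℕ) + 2 ≤ nvec N k y j ↔ (j : ℕ) < tailMass y i.succ - y i.succ := by
    by_cases hi : (i : ℕ) + 1 < N
    · have e : i.succ = (⟨i + 1, hi⟩ : Fin N).castSucc := Fin.ext rfl
      have h3 := le_nvec_iff hy j (⟨i + 1, hi⟩ : Fin N).succ
      rw [e, tailMass_castSucc]
      simpa [Nat.succ_le_iff] using h3
    · have e : i.succ = Fin.last N := by ext; simp; omega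
      have := nvec_le y j
      rw [e, tailMass_last]
      omega
  rw [Fin.val_succ] at h1
  omega

theorem sum_moveY {N : ℕ} (y : Fin (N + 1) → ℕ) (i : Fin N) (hi : 0 < y i.succ) :
    ∑ v, moveY y i 1 v = ∑ v, y v := by
  rw [← tailMass_zero, ← tailMass_zero, tailMass_moveY y i hi, if_neg (Fin.succ_ne_zero i).symm]

theorem nvec_moveY {N k : ℕ} {y : Fin (N + 1) → ℕ} (hy : ∑ v, y v = k) (i : Fin N)
    (hi : 0 < y i.succ) (l : Fin k) (hl : (l : ℕ) + 1 = tailMass y i.succ) :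
    (fun j => (nvec N k (moveY y i 1) j : ℤ)) =
      Function.update (fun j => (nvec N k y j : ℤ)) l ((nvec N k y l : ℤ) - 1) := by
  have hy' : ∑ v, moveY y i 1 v = k := (sum_moveY y i hi).trans hy
  have hle : y i.succ ≤ tailMass y i.succ :=
    Finset.single_le_sum (f := y) (fun _ _ => Nat.zero_le _) (Finset.mem_Ici.2 le_rfl)
  have hnl : nvec N k y l = i + 1 := (nvec_eq_succ_iff hy l i).2 ⟨by omega, by omega⟩
  have key : ∀ j (v : Fin (N + 1)), ((v : ℕ) ≤ nvec N k (moveY y i 1) j ↔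
      (v : ℕ) ≤ nvec N k y j ∧ ¬ (j = l ∧ v = i.succ)) := by
    intro j v
    rw [le_nvec_iff hy', le_nvec_iff hy, tailMass_moveY y i hi, Fin.ext_iff (a := j)]
    split_ifs with h
    · subst h
      simp only [and_true]
      omega
    · simp [h]
  funext j
  by_cases hj : j = l
  · subst hj
    rw [Function.update_self, hnl]
    have h1 := key j i.succ
    have h2 := key j i.castSucc
    have h3 : i.castSucc ≠ i.succ := Fin.castSucc_lt_succ.ne
    simp only [Fin.val_succ, Fin.val_castSucc, hnl, h3, and_false, not_false_eq_true, and_true,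
      not_true_eq_false, iff_false] at h1 h2
    push_cast
    omega
  · rw [Function.update_of_ne hj]
    replace key := fun v => (key j v).trans (and_iff_left fun h => hj h.1)
    have h1 := (key ⟨_, Nat.lt_succ_of_le (nvec_le (moveY y i 1) j)⟩).1 le_rfl
    have h2 := (key ⟨_, Nat.lt_succ_of_le (nvec_le y j)⟩).2 le_rfl
    exact congrArg _ (le_antisymm h1 h2)

theorem nvec_last_eq_zero {N k : ℕ} {y : Fin (N + 1) → ℕ} (hy : ∑ v, y v = k) (h0 : 0 < y 0)
    (l : Fin k) (hl : (l : ℕ) + 1 = k) : nvec N k y l = 0 := by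
  rcases Nat.eq_zero_or_pos (nvec N k y l) with h | h
  · exact h
  · exfalso
    obtain _ | N := N
    · exact absurd (nvec_le y l) (by omega)
    · have h1 := (le_nvec_iff hy l (Fin.succ 0)).1 (by rw [Fin.val_succ]; exact h)
      have h2 := tailMass_castSucc y 0
      rw [Fin.castSucc_zero, tailMass_zero, hy] at h2
      omega

theorem one_le_nvec {N k : ℕ} (hN : 1 ≤ N) {y : Fin (N + 1) → ℕ} (hy : ∑ v, y v = k)
    (h0 : y 0 = 0) (j : Fin k) : 1 ≤ nvec N k y j := by
  obtain ⟨M, rfl⟩ : ∃ M, N = M + 1 := ⟨N - 1, by omega⟩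
  have h1 := le_nvec_iff hy j (Fin.succ 0)
  have h2 := tailMass_castSucc y 0
  rw [Fin.castSucc_zero, tailMass_zero, hy, h0, zero_add] at h2
  rw [← h2] at h1
  simpa using h1.2 j.2

/-- A finite geometric sum anchored at its last term. -/
theorem one_sub_mul_sum_eq_of_geometric (q : ℝ) (D : ℕ → ℝ) (s c : ℕ)
    (hD : ∀ j, s ≤ j → j + 1 < s + c → D j = q * D (j + 1)) :
    (1 - q) * ∑ j ∈ Finset.Ico s (s + c), D j = (1 - q ^ c) * D (s + c - 1) := by
  induction c with
  | zero => simp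
  | succ c ih =>
    rw [← add_assoc, Finset.sum_Ico_succ_top (by omega), mul_add,
      ih fun j h1 h2 => hD j h1 (by omega), Nat.add_sub_cancel]
    rcases Nat.eq_zero_or_pos c with h | h
    · subst h; simp
    · have := hD (s + c - 1) (by omega) (by omega)
      rw [Nat.sub_add_cancel (by omega)] at this
      rw [this]
      ring

/-- The contribution of one cluster of equal coordinates to the free generator. -/
theorem one_sub_mul_sum_nablaD_cluster {N k : ℕ} (q : ℝ) (f : (Fin k → ℤ) → ℝ)
    (hf : ∀ (i : ℕ) (hi : i + 1 < k) (n : Fin k → ℤ), n ⟨i, by omega⟩ = n ⟨i + 1, hi⟩ →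
      nablaD ⟨i, by omega⟩ f n - q * nablaD ⟨i + 1, hi⟩ f n = 0)
    {y : Fin (N + 1) → ℕ} (hy : ∑ v, y v = k) (i : Fin N) :
    (1 - q) * ∑ j with nvec N k y j = i + 1, nablaD j f (fun j => (nvec N k y j : ℤ)) =
      (1 - q ^ y i.succ) * (f (fun j => (nvec N k (moveY y i 1) j : ℤ)) -
        f (fun j => (nvec N k y j : ℤ))) := by
  set n : Fin k → ℤ := fun j => (nvec N k y j : ℤ) with hn
  have hle : y i.succ ≤ tailMass y i.succ :=
    Finset.single_le_sum (f := y) (fun _ _ => Nat.zero_le _) (Finset.mem_Ici.2 le_rfl)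
  have hTk : tailMass y i.succ ≤ k := by
    rw [← hy, ← tailMass_zero]
    exact tailMass_antitone y (Fin.zero_le _)
  obtain ⟨s, hs⟩ : ∃ s, tailMass y i.succ = s + y i.succ := ⟨_, (Nat.sub_add_cancel hle).symm⟩
  have hmem : ∀ j : Fin k, nvec N k y j = i + 1 ↔ s ≤ j ∧ (j : ℕ) < s + y i.succ := by
    intro j
    rw [nvec_eq_succ_iff hy, hs, Nat.add_sub_cancel]
  let D : ℕ → ℝ := fun j => if h : j < k then nablaD ⟨j, h⟩ f n else 0
  have hsum : ∑ j with nvec N k y j = i + 1, nablaD j f n =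
      ∑ j ∈ Finset.Ico s (s + y i.succ), D j := by
    refine Finset.sum_bij (fun j _ => (j : ℕ)) ?_ ?_ ?_ ?_
    · intro j hj
      exact Finset.mem_Ico.2 ((hmem j).1 (Finset.mem_filter.1 hj).2)
    · intro j _ j' _ h
      exact Fin.ext h
    · intro b hb
      have hb' := Finset.mem_Ico.1 hb
      exact ⟨⟨b, by omega⟩, Finset.mem_filter.2 ⟨Finset.mem_univ _, (hmem _).2 hb'⟩, rfl⟩
    · intro j _
      simp [D]
  rw [hsum, one_sub_mul_sum_eq_of_geometric]
  · rcases Nat.eq_zero_or_pos (y i.succ) with h | h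
    · simp [h]
    · have hlt : s + y i.succ - 1 < k := by omega
      rw [nvec_moveY hy i h ⟨s + y i.succ - 1, hlt⟩ (by simp only; omega)]
      simp only [D, dif_pos hlt, nablaD, hn]
  · intro j h1 h2
    have hj : j + 1 < k := by omega
    have hj' : j < k := by omega
    simp only [D, dif_pos hj, dif_pos hj']
    refine sub_eq_zero.1 (hf j hj n ?_)
    simp only [hn]
    rw [(hmem ⟨j, hj'⟩).2 ⟨h1, by simp only; omega⟩,
      (hmem ⟨j + 1, hj⟩).2 ⟨by simp only; omega, h2⟩]

theorem stmt_9 (q : ℝ) (hq : q ∈ Set.Ioo (0:ℝ) 1) (N k : ℕ) (hN : 1 ≤ N) (hk : 1 ≤ k)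
    (a : ℤ → ℝ) (ha : ∀ n : ℤ, 1 ≤ n → 0 < a n)
    (u : ℝ → (Fin k → ℤ) → ℝ)
    (h1 : ∀ t : ℝ, 0 ≤ t → ∀ n : Fin k → ℤ, (∀ i, 1 ≤ n i) →
      HasDerivWithinAt (fun τ => u τ n)
        ((1 - q) * ∑ i : Fin k, a (n i) * nablaD i (u t) n) (Set.Ici 0) t)
    (h2 : ∀ t : ℝ, 0 ≤ t → ∀ (i : ℕ) (hi : i + 1 < k) (n : Fin k → ℤ),
      n ⟨i, by omega⟩ = n ⟨i + 1, hi⟩ →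
      nablaD ⟨i, by omega⟩ (u t) n - q * nablaD ⟨i + 1, hi⟩ (u t) n = 0)
    (h3 : ∀ t : ℝ, 0 ≤ t → ∀ n : Fin k → ℤ, (∃ i, n i ≤ 0) → u t n = 0) :
    ∀ t : ℝ, 0 ≤ t → ∀ y : Fin (N + 1) → ℕ, (∑ v, y v) = k →
      HasDerivWithinAt (fun τ => u τ (fun j => (nvec N k y j : ℤ)))
        (∑ i : Fin N, Lop q (a ((i : ℕ) + 1)) i
          (fun y' => u t (fun j => (nvec N k y' j : ℤ))) y) (Set.Ici 0) t
      ∧ (0 < y 0 → u t (fun j => (nvec N k y j : ℤ)) = 0) := by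
  intro t ht y hy
  have hzero : ∀ τ, 0 ≤ τ → ∀ y' : Fin (N + 1) → ℕ, (∑ v, y' v) = k → 0 < y' 0 →
      u τ (fun j => (nvec N k y' j : ℤ)) = 0 := by
    intro τ hτ y' hy' h0
    refine h3 τ hτ _ ⟨⟨k - 1, by omega⟩, ?_⟩
    rw [nvec_last_eq_zero hy' h0 _ (by simp only; omega)]
    simp
  refine ⟨?_, hzero t ht y hy⟩
  rcases Nat.eq_zero_or_pos (y 0) with h0 | h0
  · have hpos : ∀ j, 1 ≤ nvec N k y j := one_le_nvec hN hy h0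
    convert h1 t ht (fun j => (nvec N k y j : ℤ)) (fun j => by exact_mod_cast hpos j) using 1
    have hfib := Finset.sum_fiberwise_of_maps_to
      (s := Finset.univ) (t := Finset.univ)
      (g := fun j : Fin k => (⟨nvec N k y j - 1, by
        have := nvec_le y j; have := hpos j; omega⟩ : Fin N))
      (fun _ _ => Finset.mem_univ _)
      (fun j => a (nvec N k y j) * nablaD j (u t) (fun j => (nvec N k y j : ℤ)))
    rw [← hfib, Finset.mul_sum]
    refine Finset.sum_congr rfl fun i _ => ?_
    have hset : (Finset.univ.filter fun j : Fin k => (⟨nvec N k y j - 1, by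
        have := nvec_le y j; have := hpos j; omega⟩ : Fin N) = i) =
        Finset.univ.filter fun j => nvec N k y j = i + 1 := by
      ext j
      have := hpos j
      simp only [Finset.mem_filter, Finset.mem_univ, true_and, Fin.ext_iff]
      omega
    rw [hset, Lop, mul_assoc, ← one_sub_mul_sum_nablaD_cluster q (u t) (h2 t ht) hy i,
      mul_left_comm, Finset.mul_sum _ _ (a _)]
    congr 1
    refine Finset.sum_congr rfl fun j hj => ?_
    rw [(Finset.mem_filter.1 hj).2]
    push_cast
    rfl
  · have hL : ∑ i : Fin N, Lop q (a ((i : ℕ) + 1)) i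
        (fun y' => u t (fun j => (nvec N k y' j : ℤ))) y = 0 := by
      refine Finset.sum_eq_zero fun i _ => ?_
      rcases Nat.eq_zero_or_pos (y i.succ) with h | h
      · simp [Lop, h]
      · have hm : 0 < moveY y i 1 0 := by
          unfold moveY
          by_cases hi : (0 : Fin (N + 1)) = i.castSucc
          · rw [hi, Function.update_self]; omega
          · rwa [Function.update_of_ne hi, Function.update_of_ne (Fin.succ_ne_zero i).symm]
        simp only [Lop, hzero t ht y hy h0,
          hzero t ht _ ((sum_moveY y i h).trans hy) hm, sub_zero, mul_zero]
    rw [hL]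
    exact (hasDerivWithinAt_const t (Set.Ici 0) (0 : ℝ)).congr
      (fun τ hτ => hzero τ hτ y hy h0) (hzero t ht y hy h0)
end

section
/- (Uniqueness for the Bernoulli true evolution equation.) Fix q ∈ (0,1), N ≥ 1, a_1,…,a_N > 0, β_1, β_2, … > 0, and h_0 : Y^N → ℝ with h_0(y⃗) = 0 whenever y_0 > 0. Suppose h, h′ : ℤ_{≥0} × Y^N → ℝ both satisfy: (1) for all t ≥ 0 and y⃗ ∈ Y^N, (A^{(a_1 β_{t+1})}_1 ⋯ A^{(a_N β_{t+1})}_N h(t+1;·))(y⃗) = (A^{(q a_1 β_{t+1})}_1 ⋯ A^{(q a_N β_{t+1})}_N h(t;·))(y⃗) (the operator with index N applied first); (2) h(t;y⃗) = 0 for all t whenever y_0 > 0; (3) h(0;·) = h_0; and similarly for h′. Then h = h′. -/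
/-- The coefficients `C_a(y,s)`, with the convention `C_a(y,s) = 0` for `s < 0` or `s > y`. -/
noncomputable def Cco (q a : ℝ) (y : ℕ) (s : ℤ) : ℝ :=
  if 0 ≤ s ∧ s ≤ (y : ℤ) then
    (-a) ^ s.toNat * qPoch q (-a) (y - s.toNat) *
      (qPoch q q y / (qPoch q q (y - s.toNat) * qPoch q q s.toNat))
  else 0

/-- The operator `(A^{(a)}_i f)(y⃗) = ∑_{s=0}^{y_i} C_a(y_i,s) f(y⃗^{s}_{i,i-1})`,
where `i : Fin N` denotes paper index `i+1`. -/
noncomputable def Aop {N : ℕ} (q a : ℝ) (i : Fin N) (f : (Fin (N + 1) → ℕ) → ℝ)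
    (y : Fin (N + 1) → ℕ) : ℝ :=
  ∑ s ∈ Finset.range (y i.succ + 1), Cco q a (y i.succ) (s : ℤ) * f (moveY y i s)

/-- The composition `A^{(c_1)}_1 ⋯ A^{(c_N)}_N f`, with the operator of index `N` applied first. -/
noncomputable def Acomp {N : ℕ} (q : ℝ) (c : Fin N → ℝ) (f : (Fin (N + 1) → ℕ) → ℝ) :
    (Fin (N + 1) → ℕ) → ℝ :=
  (List.finRange N).foldr (fun i g => Aop q (c i) i g) f

theorem qPoch_pos_s12 {q a : ℝ} (h : ∀ i : ℕ, a * q ^ i < 1) (n : ℕ) : 0 < qPoch q a n :=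
  Finset.prod_pos fun i _ => sub_pos.2 (h i)

theorem Cco_zero_pos {q c : ℝ} (hq : q ∈ Set.Ioo (0 : ℝ) 1) (hc : 0 < c) (y : ℕ) :
    0 < Cco q c y 0 := by
  have hqq : ∀ n, 0 < qPoch q q n := qPoch_pos_s12 fun i => by
    rw [← pow_succ']
    exact pow_lt_one₀ hq.1.le hq.2 i.succ_ne_zero
  have hqc : 0 < qPoch q (-c) y := qPoch_pos_s12 (fun i => by
    have := mul_pos hc (pow_pos hq.1 i)
    linarith) y
  have h1 := hqq y
  have h2 := hqq 0
  simp only [Cco, le_refl, Nat.cast_nonneg, and_self, if_true, Int.toNat_zero, pow_zero, one_mul,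
    Nat.sub_zero]
  positivity

theorem moveY_zero {N : ℕ} (y : Fin (N + 1) → ℕ) (i : Fin N) : moveY y i 0 = y := by
  simp [moveY]

theorem moveY_succ_apply {N : ℕ} (y : Fin (N + 1) → ℕ) (i : Fin N) (s : ℕ) :
    moveY y i s i.succ = y i.succ - s := by
  simp [moveY, Function.update_of_ne (Fin.castSucc_lt_succ (i := i)).ne']

/-- `A^{(c)}_i` is triangular with nonzero diagonal coefficients, hence injective. -/
theorem Aop_injective {N : ℕ} {q c : ℝ} (hq : q ∈ Set.Ioo (0 : ℝ) 1) (hc : 0 < c) (i : Fin N) :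
    Function.Injective (Aop q c i) := by
  intro f g hfg
  have key : ∀ n : ℕ, ∀ y : Fin (N + 1) → ℕ, y i.succ = n → f y = g y := by
    intro n
    induction n using Nat.strong_induction_on with
    | _ n ih =>
      intro y hy
      have h := congrFun hfg y
      simp only [Aop, Finset.sum_range_succ', Nat.cast_zero, moveY_zero] at h
      have htail : ∀ s ∈ Finset.range (y i.succ),
          Cco q c (y i.succ) ((s + 1 : ℕ) : ℤ) * f (moveY y i (s + 1)) =
            Cco q c (y i.succ) ((s + 1 : ℕ) : ℤ) * g (moveY y i (s + 1)) := fun s hs => by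
        have hs := Finset.mem_range.1 hs
        rw [ih (y i.succ - (s + 1)) (by omega) _ (moveY_succ_apply y i (s + 1))]
      rw [Finset.sum_congr rfl htail] at h
      exact mul_left_cancel₀ (Cco_zero_pos hq hc _).ne' (add_left_cancel h)
  exact funext fun y => key _ y rfl

theorem Acomp_injective {N : ℕ} {q : ℝ} {c : Fin N → ℝ} (hq : q ∈ Set.Ioo (0 : ℝ) 1)
    (hc : ∀ i, 0 < c i) : Function.Injective (Acomp q c) := by
  intro f g hfg
  unfold Acomp at hfg
  generalize List.finRange N = l at hfg
  induction l with
  | nil => exact hfg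
  | cons i l ih => exact ih (Aop_injective hq (hc i) i hfg)

theorem stmt_12 (q : ℝ) (hq : q ∈ Set.Ioo (0:ℝ) 1) (N : ℕ) (hN : 1 ≤ N)
    (a : Fin N → ℝ) (ha : ∀ i, 0 < a i)
    (β : ℕ → ℝ) (hβ : ∀ s : ℕ, 1 ≤ s → 0 < β s)
    (h0 : (Fin (N + 1) → ℕ) → ℝ) (hh0 : ∀ y : Fin (N + 1) → ℕ, 0 < y 0 → h0 y = 0)
    (h h' : ℕ → (Fin (N + 1) → ℕ) → ℝ)
    (heq : ∀ t : ℕ, ∀ y : Fin (N + 1) → ℕ,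
      Acomp q (fun i => a i * β (t + 1)) (h (t + 1)) y
        = Acomp q (fun i => q * (a i * β (t + 1))) (h t) y)
    (hvan : ∀ t : ℕ, ∀ y : Fin (N + 1) → ℕ, 0 < y 0 → h t y = 0)
    (hinit : h 0 = h0)
    (heq' : ∀ t : ℕ, ∀ y : Fin (N + 1) → ℕ,
      Acomp q (fun i => a i * β (t + 1)) (h' (t + 1)) y
        = Acomp q (fun i => q * (a i * β (t + 1))) (h' t) y)
    (hvan' : ∀ t : ℕ, ∀ y : Fin (N + 1) → ℕ, 0 < y 0 → h' t y = 0)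
    (hinit' : h' 0 = h0) :
    h = h' := by
  funext t
  induction t with
  | zero => rw [hinit, hinit']
  | succ t ih =>
    refine Acomp_injective hq (fun i => mul_pos (ha i) (hβ (t + 1) (by omega))) (funext fun y => ?_)
    rw [heq, heq', ih]
end
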